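/- Let n ≥ 1, s ∈ (0, 1), and 1 < p < n/s, and set q = np/(n − sp). Then there exists a constant C > 0 depending only on n, s, p such that for every Schwartz function f on ℝⁿ, ‖f‖_{L^q(ℝⁿ)} ≤ C ‖(−Δ)^{s/2} f‖_{L^p(ℝⁿ)}, where (−Δ)^{s/2} f is the function whose Fourier transform is (2π|ξ|)^s f̂(ξ). -/

import Mathlib

open MeasureTheory Real
open scoped FourierTransform

noncomputable def lpNorm (n : ℕ) (p : ℝ) (f : EuclideanSpace ℝ (Fin n) → ℂ) : ℝ :=
  (∫ x, ‖f x‖ ^ p) ^ (1 / p)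

noncomputable def fracLap (n : ℕ) (s : ℝ) (f : EuclideanSpace ℝ (Fin n) → ℂ) :
    EuclideanSpace ℝ (Fin n) → ℂ :=
  𝓕⁻ (fun ξ : EuclideanSpace ℝ (Fin n) => (((2 * π * ‖ξ‖) ^ s : ℝ) : ℂ) * 𝓕 f ξ)

section HeatKernel

variable {V : Type*} [NormedAddCommGroup V] [InnerProductSpace ℝ V]

/-- The heat kernel `(4πt)^(-d/2) exp(-‖x‖²/(4t))` on a `d`-dimensional Euclidean space. -/
noncomputable def heatKernel (t : ℝ) (x : V) : ℝ :=
  (4 * π * t) ^ (-(Module.finrank ℝ V / 2 : ℝ)) * exp (-(4 * t)⁻¹ * ‖x‖ ^ 2)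

lemma heatKernel_nonneg {t : ℝ} (ht : 0 ≤ t) (x : V) : 0 ≤ heatKernel t x := by
  unfold heatKernel; positivity

lemma heatKernel_le {t : ℝ} (ht : 0 < t) (x : V) :
    heatKernel t x ≤ (4 * π * t) ^ (-(Module.finrank ℝ V / 2 : ℝ)) := by
  refine mul_le_of_le_one_right (by positivity) (exp_le_one_iff.2 ?_)
  rw [neg_mul, neg_nonpos]
  positivity

lemma continuous_heatKernel (t : ℝ) : Continuous (heatKernel t : V → ℝ) := by
  unfold heatKernel; fun_prop

/-- The first absolute moment of the heat kernel is of order `√t`, in a pointwise form. -/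
lemma heatKernel_mul_norm_le {t : ℝ} (ht : 0 < t) (x : V) :
    heatKernel t x * ‖x‖ ≤
      2 * 2 ^ (Module.finrank ℝ V / 2 : ℝ) * t ^ (1 / 2 : ℝ) * heatKernel (2 * t) x := by
  have key : ‖x‖ ≤ 2 * t ^ (1 / 2 : ℝ) * exp ((4 * (2 * t))⁻¹ * ‖x‖ ^ 2) := by
    have h1 := add_one_le_exp ((4 * (2 * t))⁻¹ * ‖x‖ ^ 2)
    rw [← sqrt_eq_rpow]
    have hs := Real.mul_self_sqrt ht.le
    have hs0 := Real.sqrt_pos.2 ht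
    set r := √t
    refine le_trans ?_ (mul_le_mul_of_nonneg_left h1 (by positivity))
    rw [← hs]
    have : 2 * r * ((4 * (2 * (r * r)))⁻¹ * ‖x‖ ^ 2 + 1) - ‖x‖
        = ((‖x‖ - 2 * r) ^ 2 + 4 * r ^ 2) / (4 * r) := by
      field_simp
      ring
    have h2 : 0 ≤ ((‖x‖ - 2 * r) ^ 2 + 4 * r ^ 2) / (4 * r) := by positivity
    linarith
  unfold heatKernel
  have e1 : (4 * π * (2 * t)) ^ (-(Module.finrank ℝ V / 2 : ℝ)) =
      2 ^ (-(Module.finrank ℝ V / 2 : ℝ)) * (4 * π * t) ^ (-(Module.finrank ℝ V / 2 : ℝ)) := by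
    rw [← mul_rpow (by positivity) (by positivity)]; ring_nf
  have e2 : exp (-(4 * t)⁻¹ * ‖x‖ ^ 2) * exp ((4 * (2 * t))⁻¹ * ‖x‖ ^ 2)
      = exp (-(4 * (2 * t))⁻¹ * ‖x‖ ^ 2) := by
    rw [← exp_add]; congr 1; field_simp; ring
  have e3 : (2 : ℝ) ^ (Module.finrank ℝ V / 2 : ℝ) * 2 ^ (-(Module.finrank ℝ V / 2 : ℝ)) = 1 := by
    rw [← rpow_add two_pos]; simp
  calc _ ≤ (4 * π * t) ^ (-(Module.finrank ℝ V / 2 : ℝ)) * exp (-(4 * t)⁻¹ * ‖x‖ ^ 2) *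
        (2 * t ^ (1 / 2 : ℝ) * exp ((4 * (2 * t))⁻¹ * ‖x‖ ^ 2)) := by gcongr
    _ = ((2 : ℝ) ^ (Module.finrank ℝ V / 2 : ℝ) * 2 ^ (-(Module.finrank ℝ V / 2 : ℝ))) *
        (4 * π * t) ^ (-(Module.finrank ℝ V / 2 : ℝ)) * (2 * t ^ (1 / 2 : ℝ)) *
        (exp (-(4 * t)⁻¹ * ‖x‖ ^ 2) * exp ((4 * (2 * t))⁻¹ * ‖x‖ ^ 2)) := by rw [e3]; ring
    _ = _ := by rw [e1, e2]; ring

variable [MeasurableSpace V] [BorelSpace V]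

lemma measurable_heatKernel_uncurry :
    Measurable (fun p : ℝ × V ↦ heatKernel p.1 p.2) := by
  unfold heatKernel; fun_prop

lemma measurable_heatKernel (t : ℝ) : Measurable (heatKernel t : V → ℝ) :=
  (continuous_heatKernel t).measurable

variable [FiniteDimensional ℝ V]

lemma integral_heatKernel {t : ℝ} (ht : 0 < t) : ∫ x : V, heatKernel t x = 1 := by
  unfold heatKernel
  rw [integral_const_mul, GaussianFourier.integral_rexp_neg_mul_sq_norm (by positivity),
    show π / (4 * t)⁻¹ = 4 * π * t by field_simp, ← rpow_add (by positivity)]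
  simp

lemma integrable_heatKernel {t : ℝ} (ht : 0 < t) : Integrable (heatKernel t : V → ℝ) :=
  .of_integral_ne_zero (by rw [integral_heatKernel ht]; exact one_ne_zero)

lemma lintegral_heatKernel {t : ℝ} (ht : 0 < t) :
    ∫⁻ x : V, ENNReal.ofReal (heatKernel t x) = 1 := by
  rw [← ofReal_integral_eq_lintegral_ofReal (integrable_heatKernel ht)
    (.of_forall (heatKernel_nonneg ht.le)), integral_heatKernel ht, ENNReal.ofReal_one]

lemma lintegral_heatKernel_sub {t : ℝ} (ht : 0 < t) (x : V) :
    ∫⁻ y : V, ENNReal.ofReal (heatKernel t (x - y)) = 1 := by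
  rw [lintegral_sub_left_eq_self (fun y ↦ ENNReal.ofReal (heatKernel t y)) x,
    lintegral_heatKernel ht]

lemma lintegral_heatKernel_sub' {t : ℝ} (ht : 0 < t) (y : V) :
    ∫⁻ x : V, ENNReal.ofReal (heatKernel t (x - y)) = 1 := by
  rw [lintegral_sub_right_eq_self (fun y ↦ ENNReal.ofReal (heatKernel t y)) y,
    lintegral_heatKernel ht]

/-- Convolving an inverse Fourier transform with the heat kernel multiplies the symbol
by a Gaussian. -/
lemma integral_heatKernel_mul_fourierInv {t : ℝ} (ht : 0 < t) {h : V → ℂ} (hh : Integrable h)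
    (x : V) :
    ∫ y, (heatKernel t (x - y) : ℂ) * 𝓕⁻ h y =
      𝓕⁻ (fun ξ ↦ ((exp (-t * (2 * π * ‖ξ‖) ^ 2) : ℝ) : ℂ) * h ξ) x := by
  set b : ℂ := ((4 * π ^ 2 * t : ℝ) : ℂ) with hb
  have hbr : 0 < b.re := by rw [hb, Complex.ofReal_re]; positivity
  set φ : V → ℂ := fun v ↦ Complex.exp (-b * ‖v‖ ^ 2 + 2 * π * Complex.I * inner ℝ x v) with hφ
  have hφi : Integrable φ := GaussianFourier.integrable_cexp_neg_mul_sq_norm_add hbr _ _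
  have hφF : 𝓕 φ = fun w ↦ (heatKernel t (x - w) : ℂ) := by
    ext w
    rw [hφ, fourier_gaussian_innerProductSpace' hbr, heatKernel]
    push_cast
    congr 1
    · rw [Complex.ofReal_cpow (by positivity), show (π : ℂ) / b = ((4 * π * t)⁻¹ : ℝ) by
        rw [hb]; push_cast; field_simp]
      push_cast
      rw [Complex.cpow_neg, ← Complex.inv_cpow]
      rw [show (4 * (π : ℂ) * t) = ((4 * π * t : ℝ) : ℂ) by push_cast; ring,
        Complex.arg_ofReal_of_nonneg (by positivity)]
      exact pi_ne_zero.symm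
    · congr 1
      rw [hb]; push_cast; field_simp
  have hψi : Integrable (𝓕 φ) := by
    rw [hφF]
    exact ((integrable_heatKernel ht).comp_sub_left x).ofReal
  have hinv : 𝓕⁻ (𝓕 φ) = φ := Continuous.fourierInv_fourier_eq (by fun_prop) hφi hψi
  have hflip : ∫ y, 𝓕 (fun ξ ↦ h (-ξ)) y • 𝓕 φ y = ∫ ξ, h (-ξ) • 𝓕 (𝓕 φ) ξ := by
    simpa using! (VectorFourier.integral_fourierIntegral_smul_eq_flip (L := innerₗ V)
      Real.continuous_fourierChar continuous_inner hh.comp_neg hψi)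
  calc _ = ∫ y, 𝓕 (fun ξ ↦ h (-ξ)) y • 𝓕 φ y := by
        rw [fourierInv_eq_fourier_comp_neg, hφF]
        simp [mul_comm]
    _ = ∫ ξ, h (-ξ) • 𝓕 (𝓕 φ) ξ := hflip
    _ = ∫ ξ, h ξ • 𝓕⁻ (𝓕 φ) ξ := by
        rw [← integral_neg_eq_self]
        simp [fourierInv_eq_fourier_neg]
    _ = _ := by
        rw [hinv, fourierInv_eq']
        congr 1; ext ξ
        simp only [hφ, smul_eq_mul, hb]
        rw [Complex.exp_add, real_inner_comm]
        push_cast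
        ring_nf

end HeatKernel

section PowerIntegrals

lemma lintegral_Ioc_rpow {a T : ℝ} (ha : 0 < a) (hT : 0 ≤ T) :
    ∫⁻ t in Set.Ioc 0 T, ENNReal.ofReal (t ^ (a - 1)) = ENNReal.ofReal (T ^ a / a) := by
  have hi : IntervalIntegrable (fun t : ℝ ↦ t ^ (a - 1)) volume 0 T :=
    intervalIntegral.intervalIntegrable_rpow' (by linarith)
  rw [← ofReal_integral_eq_lintegral_ofReal, ← intervalIntegral.integral_of_le hT,
    integral_rpow (.inl (by linarith))]
  · simp [zero_rpow ha.ne']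
  · exact (intervalIntegrable_iff_integrableOn_Ioc_of_le hT).1 hi
  · filter_upwards [ae_restrict_mem measurableSet_Ioc] with t ht using rpow_nonneg ht.1.le _

lemma lintegral_Ioi_rpow {b T : ℝ} (hb : 0 < b) (hT : 0 < T) :
    ∫⁻ t in Set.Ioi T, ENNReal.ofReal (t ^ (-b - 1)) = ENNReal.ofReal (T ^ (-b) / b) := by
  rw [← ofReal_integral_eq_lintegral_ofReal (integrableOn_Ioi_rpow_of_lt (by linarith) hT),
    integral_Ioi_rpow_of_lt (by linarith) hT]
  · congr 1; rw [sub_add_cancel, neg_div, div_neg, neg_neg]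
  · filter_upwards [ae_restrict_mem measurableSet_Ioi] with t ht using
      rpow_nonneg (hT.le.trans (le_of_lt ht)) _

end PowerIntegrals

section HeatAverage

open scoped ENNReal

variable {V : Type*} [NormedAddCommGroup V] [InnerProductSpace ℝ V] [MeasurableSpace V]
  [BorelSpace V] [FiniteDimensional ℝ V]

/-- The convolution of a nonnegative function with the heat kernel. -/
noncomputable def heatAvg (t : ℝ) (G : V → ℝ≥0∞) (x : V) : ℝ≥0∞ :=
  ∫⁻ y, ENNReal.ofReal (heatKernel t (x - y)) * G y

/-- The superposition `∫₀^∞ t^(a-1) e^{tΔ} G dt`, a multiple of the Riesz potential of order `2a`. -/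
noncomputable def heatPotential (a : ℝ) (G : V → ℝ≥0∞) (x : V) : ℝ≥0∞ :=
  ∫⁻ t in Set.Ioi 0, ENNReal.ofReal (t ^ (a - 1)) * heatAvg t G x

lemma measurable_heatAvg_uncurry {G : V → ℝ≥0∞} (hG : Measurable G) :
    Measurable (fun z : ℝ × V ↦ heatAvg z.1 G z.2) := by
  unfold heatAvg
  refine Measurable.lintegral_prod_right'
    (f := fun w : (ℝ × V) × V ↦ ENNReal.ofReal (heatKernel w.1.1 (w.1.2 - w.2)) * G w.2) ?_
  refine Measurable.mul ?_ (hG.comp measurable_snd)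
  exact ENNReal.measurable_ofReal.comp (measurable_heatKernel_uncurry.comp
    (f := fun w : (ℝ × V) × V ↦ (w.1.1, w.1.2 - w.2)) (by fun_prop))

lemma measurable_heatAvg (t : ℝ) {G : V → ℝ≥0∞} (hG : Measurable G) :
    Measurable (heatAvg t G) :=
  (measurable_heatAvg_uncurry hG).comp (f := fun x : V ↦ (t, x)) (by fun_prop)

lemma lintegral_heatAvg {t : ℝ} (ht : 0 < t) {G : V → ℝ≥0∞} (hG : Measurable G) :
    ∫⁻ x, heatAvg t G x = ∫⁻ y, G y := by
  unfold heatAvg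
  rw [lintegral_lintegral_swap]
  · refine lintegral_congr fun y ↦ ?_
    have := measurable_heatKernel (V := V) t
    rw [lintegral_mul_const _ (by fun_prop), lintegral_heatKernel_sub' ht, one_mul]
  · have := measurable_heatKernel (V := V) t
    unfold Function.uncurry
    fun_prop

lemma heatAvg_le_add {t : ℝ} (ht : 0 < t) (G : V → ℝ≥0∞) (δ : ℝ≥0∞) (x : V) :
    heatAvg t G x ≤ heatAvg t ({y | δ < G y}.indicator G) x + δ := by
  have hm := measurable_heatKernel (V := V) t
  calc heatAvg t G x
      ≤ ∫⁻ y, (ENNReal.ofReal (heatKernel t (x - y)) * {y | δ < G y}.indicator G y +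
          ENNReal.ofReal (heatKernel t (x - y)) * δ) := by
        refine lintegral_mono fun y ↦ ?_
        rw [← mul_add]
        gcongr
        by_cases h : δ < G y
        · simp [h]
        · rw [Set.indicator_of_notMem (by simpa using h), zero_add]
          exact not_lt.1 h
    _ = _ := by
        rw [lintegral_add_right _ (by fun_prop), lintegral_mul_const _ (by fun_prop),
          lintegral_heatKernel_sub ht, one_mul, heatAvg]

/-- The smoothing estimate `‖e^{tΔ} G‖_∞ ≤ t^(-d/(2p)) ‖G‖_p`. -/
lemma heatAvg_le_of_lintegral_rpow_le_one {t p : ℝ} (ht : 0 < t) (hp : 1 < p) {G : V → ℝ≥0∞}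
    (hG : Measurable G) (hG1 : ∫⁻ y, G y ^ p ≤ 1) (x : V) :
    heatAvg t G x ≤ ENNReal.ofReal (t ^ (-(Module.finrank ℝ V / (2 * p) : ℝ))) := by
  have hm := measurable_heatKernel (V := V) t
  have hp0 : 0 < p := by linarith
  set p' := p.conjExponent
  have hpq : p'.HolderConjugate p := (Real.HolderConjugate.conjExponent hp).symm
  set k : V → ℝ≥0∞ := fun y ↦ ENNReal.ofReal (heatKernel t (x - y))
  have hk : Measurable k := by fun_prop
  have hk1 : ∫⁻ y, k y = 1 := lintegral_heatKernel_sub ht x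
  calc heatAvg t G x = ∫⁻ y, ((fun y ↦ k y ^ (1 / p')) * fun y ↦ k y ^ (1 / p) * G y) y := by
        refine lintegral_congr fun y ↦ ?_
        simp only [Pi.mul_apply]
        rw [← mul_assoc, ← ENNReal.rpow_add_of_nonneg _ _ (one_div_nonneg.2 hpq.pos.le)
          (one_div_nonneg.2 hp0.le)]
        rw [one_div, one_div, hpq.inv_add_inv_eq_one, ENNReal.rpow_one]
    _ ≤ (∫⁻ y, (k y ^ (1 / p')) ^ p') ^ (1 / p') *
          (∫⁻ y, (k y ^ (1 / p) * G y) ^ p) ^ (1 / p) :=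
        ENNReal.lintegral_mul_le_Lp_mul_Lq _ hpq (by fun_prop) (by fun_prop)
    _ = (∫⁻ y, k y * G y ^ p) ^ (1 / p) := by
        have h1 : ∀ y, (k y ^ (1 / p')) ^ p' = k y := fun y ↦ by
          rw [← ENNReal.rpow_mul, one_div_mul_cancel hpq.pos.ne', ENNReal.rpow_one]
        have h2 : ∀ y, (k y ^ (1 / p) * G y) ^ p = k y * G y ^ p := fun y ↦ by
          rw [ENNReal.mul_rpow_of_nonneg _ _ hp0.le, ← ENNReal.rpow_mul,
            one_div_mul_cancel hp0.ne', ENNReal.rpow_one]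
        simp only [h1, h2, hk1, ENNReal.one_rpow, one_mul]
    _ ≤ (∫⁻ y, ENNReal.ofReal (t ^ (-(Module.finrank ℝ V / 2 : ℝ))) * G y ^ p) ^ (1 / p) := by
        gcongr with y
        refine ENNReal.ofReal_le_ofReal ((heatKernel_le ht _).trans
          (rpow_le_rpow_of_nonpos ht ?_ (by rw [neg_nonpos]; positivity)))
        nlinarith [pi_gt_three]
    _ ≤ (ENNReal.ofReal (t ^ (-(Module.finrank ℝ V / 2 : ℝ)))) ^ (1 / p) := by
        rw [lintegral_const_mul _ (by fun_prop)]
        gcongr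
        exact mul_le_of_le_one_right' hG1
    _ = _ := by
        rw [ENNReal.ofReal_rpow_of_nonneg (by positivity) (by positivity), ← rpow_mul ht.le]
        congr 2
        field_simp

/-- A distributional estimate for `heatPotential`, sharp enough to be integrated directly into
the strong-type Hardy–Littlewood–Sobolev inequality. -/
lemma measure_heatPotential_gt_le {a b p l : ℝ} (ha : 0 < a) (hb : 0 < b) (hp : 1 < p)
    (hab : a + b = Module.finrank ℝ V / (2 * p)) (hl : 0 < l) {G : V → ℝ≥0∞}
    (hG : Measurable G) (hG1 : ∫⁻ y, G y ^ p ≤ 1) {δ : ℝ}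
    (hδ : δ = a / 4 * l * (b * l / 2) ^ (a / b)) :
    volume {x | ENNReal.ofReal l < heatPotential a G x} ≤
      ENNReal.ofReal δ⁻¹ * ∫⁻ y, {y | ENNReal.ofReal δ < G y}.indicator G y := by
  set T : ℝ := (b * l / 2) ^ (-(1 / b)) with hT
  have hT0 : 0 < T := by positivity
  have hTb : T ^ (-b) / b = l / 2 := by
    rw [hT, ← rpow_mul (by positivity), show -(1 / b) * -b = 1 by field_simp, rpow_one]
    field_simp
  have hδT : δ = a / 4 * l * (T ^ a)⁻¹ := by
    rw [hδ, hT, ← rpow_mul (by positivity), ← rpow_neg (by positivity)]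
    congr 2; field_simp
  have hTa : 0 < T ^ a := by positivity
  have hδ0 : 0 < δ := by rw [hδT]; positivity
  set G₁ := {y | ENNReal.ofReal δ < G y}.indicator G
  have hG₁ : Measurable G₁ := hG.indicator (measurableSet_lt measurable_const hG)
  set H : V → ℝ≥0∞ := fun x ↦ ∫⁻ t in Set.Ioc 0 T, ENNReal.ofReal (t ^ (a - 1)) * heatAvg t G₁ x
  have hjm := measurable_heatAvg_uncurry hG₁
  have hjm' : Measurable (fun z : V × ℝ ↦
      ENNReal.ofReal (z.2 ^ (a - 1)) * heatAvg z.2 G₁ z.1) :=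
    Measurable.mul (by fun_prop) (hjm.comp (f := fun z : V × ℝ ↦ (z.2, z.1)) (by fun_prop))
  have hH : Measurable H := Measurable.lintegral_prod_right' hjm'
  have hsplit (x : V) : heatPotential a G x ≤ H x + ENNReal.ofReal (3 * l / 4) := by
    have h1 : ∫⁻ t in Set.Ioc 0 T, ENNReal.ofReal (t ^ (a - 1)) * heatAvg t G x ≤
        H x + ENNReal.ofReal (l / 4) := by
      calc _ ≤ ∫⁻ t in Set.Ioc 0 T, (ENNReal.ofReal (t ^ (a - 1)) * heatAvg t G₁ x +
            ENNReal.ofReal (t ^ (a - 1)) * ENNReal.ofReal δ) := by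
            refine setLIntegral_mono' measurableSet_Ioc fun t ht ↦ ?_
            rw [← mul_add]
            gcongr
            exact heatAvg_le_add ht.1 G _ x
        _ = H x + ENNReal.ofReal (l / 4) := by
            rw [lintegral_add_right _ (by fun_prop), lintegral_mul_const _ (by fun_prop),
              lintegral_Ioc_rpow ha hT0.le, ← ENNReal.ofReal_mul (by positivity)]
            congr 2
            rw [hδT]; field_simp
    have h2 : ∫⁻ t in Set.Ioi T, ENNReal.ofReal (t ^ (a - 1)) * heatAvg t G x ≤
        ENNReal.ofReal (l / 2) := by
      calc _ ≤ ∫⁻ t in Set.Ioi T, ENNReal.ofReal (t ^ (-b - 1)) := by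
            refine setLIntegral_mono' measurableSet_Ioi fun t ht ↦ ?_
            have ht0 : 0 < t := hT0.trans ht
            calc _ ≤ ENNReal.ofReal (t ^ (a - 1)) *
                  ENNReal.ofReal (t ^ (-(Module.finrank ℝ V / (2 * p) : ℝ))) := by
                  gcongr
                  exact heatAvg_le_of_lintegral_rpow_le_one ht0 hp hG hG1 x
              _ = _ := by
                  rw [← ENNReal.ofReal_mul (by positivity), ← rpow_add ht0, ← hab]
                  ring_nf
        _ = _ := by rw [lintegral_Ioi_rpow hb hT0, hTb]
    calc heatPotential a G x
        = (∫⁻ t in Set.Ioc 0 T, ENNReal.ofReal (t ^ (a - 1)) * heatAvg t G x) +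
          ∫⁻ t in Set.Ioi T, ENNReal.ofReal (t ^ (a - 1)) * heatAvg t G x := by
          rw [heatPotential, ← Set.Ioc_union_Ioi_eq_Ioi hT0.le,
            lintegral_union measurableSet_Ioi (Set.Ioc_disjoint_Ioi le_rfl)]
      _ ≤ (H x + ENNReal.ofReal (l / 4)) + ENNReal.ofReal (l / 2) := add_le_add h1 h2
      _ = _ := by
          rw [add_assoc, ← ENNReal.ofReal_add (by positivity) (by positivity)]
          ring_nf
  have hHint : ∫⁻ x, H x = ENNReal.ofReal (T ^ a / a) * ∫⁻ y, G₁ y := by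
    rw [lintegral_lintegral_swap hjm'.aemeasurable]
    calc _ = ∫⁻ t in Set.Ioc 0 T, ENNReal.ofReal (t ^ (a - 1)) * ∫⁻ y, G₁ y := by
          refine setLIntegral_congr_fun measurableSet_Ioc fun t ht ↦ ?_
          rw [lintegral_const_mul _ (measurable_heatAvg t hG₁), lintegral_heatAvg ht.1 hG₁]
      _ = _ := by rw [lintegral_mul_const _ (by fun_prop), lintegral_Ioc_rpow ha hT0.le]
  have hl4 : ENNReal.ofReal (l / 4) ≠ 0 := by simpa using hl
  calc volume {x | ENNReal.ofReal l < heatPotential a G x}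
      ≤ volume {x | ENNReal.ofReal (l / 4) ≤ H x} := by
        refine measure_mono fun x (hx : ENNReal.ofReal l < heatPotential a G x) ↦ ?_
        by_contra! hx'
        have hx' : H x < ENNReal.ofReal (l / 4) := by simpa using hx'
        refine absurd (hx.trans_le (hsplit x)) (not_lt.2 ?_)
        calc H x + ENNReal.ofReal (3 * l / 4)
            ≤ ENNReal.ofReal (l / 4) + ENNReal.ofReal (3 * l / 4) := by gcongr
          _ = ENNReal.ofReal l := by
            rw [← ENNReal.ofReal_add (by positivity) (by positivity)]; ring_nf
    _ ≤ (∫⁻ x, H x) / ENNReal.ofReal (l / 4) :=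
        meas_ge_le_lintegral_div hH.aemeasurable hl4 ENNReal.ofReal_ne_top
    _ = _ := by
        rw [hHint, ENNReal.div_eq_inv_mul, ← mul_assoc,
          ← ENNReal.ofReal_inv_of_pos (by positivity), ← ENNReal.ofReal_mul (by positivity)]
        congr 2
        rw [hδT]; field_simp

/-- The Hardy–Littlewood–Sobolev inequality for `heatPotential`, normalised to `‖G‖_p ≤ 1`. -/
lemma exists_lintegral_rpow_le_of_le_heatPotential {a b p q : ℝ} (ha : 0 < a) (hb : 0 < b)
    (hp : 1 < p) (hab : a + b = Module.finrank ℝ V / (2 * p))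
    (hbq : b = Module.finrank ℝ V / (2 * q)) :
    ∃ C : ℝ, 0 < C ∧ ∀ f G : V → ℝ, Measurable f → Measurable G → (∀ x, 0 ≤ f x) →
      (∀ x, 0 ≤ G x) → (∀ x, ENNReal.ofReal (f x) ≤ heatPotential a (ENNReal.ofReal ∘ G) x) →
      ∫⁻ y, ENNReal.ofReal (G y ^ p) ≤ 1 → ∫⁻ x, ENNReal.ofReal (f x ^ q) ≤ ENNReal.ofReal C := by
  have hp0 : 0 < p := by linarith
  have hd : (0 : ℝ) < Module.finrank ℝ V := by
    by_contra! h
    have : (Module.finrank ℝ V : ℝ) / (2 * p) ≤ 0 := div_nonpos_of_nonpos_of_nonneg h (by linarith)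
    linarith
  have hq : 0 < q := by
    by_contra! h
    have : (Module.finrank ℝ V : ℝ) / (2 * q) ≤ 0 :=
      div_nonpos_of_nonneg_of_nonpos hd.le (by linarith)
    linarith
  set r := q / p with hr
  have hr0 : 0 < r := by positivity
  have hrq : r < q := div_lt_self hq hp
  have hrab : 1 + a / b = r := by
    rw [hr, one_add_div hb.ne', add_comm, hab, hbq]; field_simp
  set c := a / 4 * (b / 2) ^ (a / b) with hc
  have hc0 : 0 < c := by positivity
  refine ⟨q * ((c ^ p)⁻¹ / (q - r)), mul_pos hq (div_pos (by positivity) (by linarith)), ?_⟩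
  intro f G hf hG hf0 hG0 hfG hG1
  have hG1' : ∫⁻ y, (ENNReal.ofReal ∘ G) y ^ p ≤ 1 := by
    simpa [ENNReal.ofReal_rpow_of_nonneg (hG0 _) hp0.le] using hG1
  have hδ {l : ℝ} (hl : 0 < l) : c * l ^ r = a / 4 * l * (b * l / 2) ^ (a / b) := by
    rw [← hrab, rpow_add hl, rpow_one, hc, show b * l / 2 = b / 2 * l by ring,
      mul_rpow (by positivity) hl.le]
    ring
  set F : ℝ → V → ℝ≥0∞ := fun l x ↦ {z : ℝ × V | c * z.1 ^ r < G z.2}.indicator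
    (fun z ↦ ENNReal.ofReal (G z.2 * c⁻¹) * ENNReal.ofReal (z.1 ^ (q - r - 1))) (l, x)
  have hFm : Measurable (Function.uncurry F) := by
    refine Measurable.indicator (by fun_prop) (measurableSet_lt (by fun_prop) (by fun_prop))
  have hslice (x : V) : ∫⁻ l in Set.Ioi 0, F l x ≤
      ENNReal.ofReal ((c ^ p)⁻¹ / (q - r)) * ENNReal.ofReal (G x ^ p) := by
    set L := (G x * c⁻¹) ^ r⁻¹ with hL
    have hg : 0 ≤ G x * c⁻¹ := mul_nonneg (hG0 x) (by positivity)
    have hL0 : 0 ≤ L := by positivity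
    calc _ ≤ ∫⁻ l in Set.Ioi 0, (Set.Ioc 0 L).indicator (fun l ↦
          ENNReal.ofReal (G x * c⁻¹) * ENNReal.ofReal (l ^ (q - r - 1))) l := by
          refine setLIntegral_mono' measurableSet_Ioi fun l hl ↦ ?_
          have hl0 : 0 < l := hl
          by_cases h : c * l ^ r < G x
          · have hlL : l ≤ L := by
              rw [hL, le_rpow_inv_iff_of_pos hl0.le hg hr0, ← div_eq_mul_inv,
                le_div_iff₀' hc0]
              exact h.le
            simp [F, h, hl0, hlL]
          · simp [F, h]
      _ = ENNReal.ofReal (G x * c⁻¹) * ENNReal.ofReal (L ^ (q - r) / (q - r)) := by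
          rw [lintegral_indicator measurableSet_Ioc, Measure.restrict_restrict measurableSet_Ioc,
            Set.inter_eq_left.2 Set.Ioc_subset_Ioi_self, lintegral_const_mul _ (by fun_prop),
            lintegral_Ioc_rpow (by linarith) hL0]
      _ = _ := by
          have hqr : 0 < q - r := by linarith
          rw [← ENNReal.ofReal_mul hg, ← ENNReal.ofReal_mul (by positivity)]
          congr 1
          have e : L ^ (q - r) = (G x * c⁻¹) ^ (p - 1) := by
            rw [hL, ← rpow_mul hg]; congr 1; rw [hr]; field_simp
          have e' : G x * c⁻¹ * (G x * c⁻¹) ^ (p - 1) = G x ^ p * (c ^ p)⁻¹ := by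
            rw [← inv_rpow hc0.le, ← mul_rpow (hG0 x) (by positivity)]
            nth_rewrite 1 [← rpow_one (G x * c⁻¹)]
            rw [← rpow_add' hg (by linarith)]
            congr 1; ring
          rw [e, mul_div_assoc', e']; ring
  calc ∫⁻ x, ENNReal.ofReal (f x ^ q)
      = ENNReal.ofReal q * ∫⁻ l in Set.Ioi 0, volume {x | l < f x} *
          ENNReal.ofReal (l ^ (q - 1)) :=
        lintegral_rpow_eq_lintegral_meas_lt_mul _ (.of_forall hf0) hf.aemeasurable hq
    _ ≤ ENNReal.ofReal q * ∫⁻ l in Set.Ioi 0, ∫⁻ x, F l x := by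
        refine mul_le_mul_right (setLIntegral_mono' measurableSet_Ioi fun l hl ↦ ?_) _
        have hl0 : 0 < l := hl
        have hlr : 0 < l ^ r := by positivity
        have hsub : {x | l < f x} ⊆
            {x | ENNReal.ofReal l < heatPotential a (ENNReal.ofReal ∘ G) x} := fun x hx ↦
          ((ENNReal.ofReal_lt_ofReal_iff (hl0.trans hx)).2 hx).trans_le (hfG x)
        calc _ ≤ (ENNReal.ofReal (c * l ^ r)⁻¹ * ∫⁻ y,
              {y | ENNReal.ofReal (c * l ^ r) < (ENNReal.ofReal ∘ G) y}.indicator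
                (ENNReal.ofReal ∘ G) y) * ENNReal.ofReal (l ^ (q - 1)) := by
              gcongr
              exact (measure_mono hsub).trans (measure_heatPotential_gt_le ha hb hp hab hl0
                (by fun_prop) hG1' (hδ hl0))
          _ = ∫⁻ x, F l x := by
              rw [mul_right_comm, ← lintegral_const_mul _ (Measurable.indicator (by fun_prop)
                (measurableSet_lt (by fun_prop) (by fun_prop)))]
              refine lintegral_congr fun x ↦ ?_
              by_cases h : c * l ^ r < G x
              · have h' : ENNReal.ofReal (c * l ^ r) < ENNReal.ofReal (G x) :=
                  (ENNReal.ofReal_lt_ofReal_iff (lt_trans (by positivity) h)).2 h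
                simp only [F, Set.indicator, Set.mem_ofPred_eq, Function.comp, h, h', if_true]
                rw [← ENNReal.ofReal_mul (by positivity), ← ENNReal.ofReal_mul (by positivity),
                  ← ENNReal.ofReal_mul (mul_nonneg (hG0 x) (by positivity))]
                congr 1
                rw [show q - 1 = r + (q - r - 1) by ring, rpow_add hl0]
                field_simp
              · have h' : ¬ ENNReal.ofReal (c * l ^ r) < ENNReal.ofReal (G x) :=
                  not_lt.2 (ENNReal.ofReal_le_ofReal (not_lt.1 h))
                simp [F, h, h']
    _ = ENNReal.ofReal q * ∫⁻ x, ∫⁻ l in Set.Ioi 0, F l x := by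
        rw [lintegral_lintegral_swap hFm.aemeasurable]
    _ ≤ ENNReal.ofReal q * ∫⁻ x, ENNReal.ofReal ((c ^ p)⁻¹ / (q - r)) *
          ENNReal.ofReal (G x ^ p) := by
        gcongr with x
        exact hslice x
    _ ≤ ENNReal.ofReal q * (ENNReal.ofReal ((c ^ p)⁻¹ / (q - r)) * 1) := by
        rw [lintegral_const_mul _ (by fun_prop)]
        gcongr
    _ = _ := by rw [mul_one, ENNReal.ofReal_mul hq.le]

end HeatAverage

section Subordination

open scoped ENNReal

variable {V : Type*} [NormedAddCommGroup V] [InnerProductSpace ℝ V] [MeasurableSpace V]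
  [BorelSpace V] [FiniteDimensional ℝ V]

lemma fourierInv_const_mul (c : ℂ) (u : V → ℂ) (x : V) :
    𝓕⁻ (fun ξ ↦ c * u ξ) x = c * 𝓕⁻ u x := by
  simp only [fourierInv_eq]
  rw [← integral_const_mul]
  exact integral_congr_ae (.of_forall fun ξ ↦ by simp only [mul_smul_comm])

lemma integrable_fourierChar_smul {u : V → ℂ} (hu : Integrable u) (x : V) :
    Integrable (fun ξ ↦ 𝐞 (inner ℝ ξ x) • u ξ) := by
  refine (integrable_norm_iff ?_).1 (by simpa using hu.norm)
  simp only [Circle.smul_def]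
  have h : Continuous fun ξ : V ↦ (𝐞 (inner ℝ ξ x) : ℂ) := by fun_prop
  exact h.aestronglyMeasurable.smul hu.1

lemma fourierInv_sub {u v : V → ℂ} (hu : Integrable u) (hv : Integrable v) (x : V) :
    𝓕⁻ (fun ξ ↦ u ξ - v ξ) x = 𝓕⁻ u x - 𝓕⁻ v x := by
  simp only [fourierInv_eq]
  rw [← integral_sub (integrable_fourierChar_smul hu x) (integrable_fourierChar_smul hv x)]
  simp only [smul_sub]

/-- If the symbol `M` is the superposition of the nonnegative symbols `w t`, the Fourier multiplier
with symbol `M` is dominated by the superposition of those with symbols `w t`. -/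
lemma enorm_fourierInv_le_lintegral {w : ℝ → V → ℝ} (hw : Measurable (Function.uncurry w))
    (hw0 : ∀ t, 0 < t → ∀ ξ, 0 ≤ w t ξ) {M : V → ℝ} (hM0 : ∀ ξ, 0 ≤ M ξ)
    (hM : ∀ᵐ ξ, ∫⁻ t in Set.Ioi 0, ENNReal.ofReal (w t ξ) = ENNReal.ofReal (M ξ))
    {v : V → ℂ} (hv : AEStronglyMeasurable v) (hMv : Integrable fun ξ ↦ (M ξ : ℂ) * v ξ) (x : V) :
    ‖𝓕⁻ (fun ξ ↦ (M ξ : ℂ) * v ξ) x‖ₑ ≤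
      ∫⁻ t in Set.Ioi 0, ‖𝓕⁻ (fun ξ ↦ (w t ξ : ℂ) * v ξ) x‖ₑ := by
  set Φ : V → ℝ → ℂ := fun ξ t ↦ 𝐞 (inner ℝ ξ x) • ((w t ξ : ℂ) * v ξ) with hΦ
  have hw' (ξ : V) : Measurable fun t ↦ w t ξ := hw.comp (f := fun t ↦ (t, ξ)) (by fun_prop)
  have hΦm : AEStronglyMeasurable (Function.uncurry Φ)
      ((volume : Measure V).prod (volume.restrict (Set.Ioi (0 : ℝ)))) := by
    simp only [hΦ, Circle.smul_def, Function.uncurry_def]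
    have h : Continuous fun z : V × ℝ ↦ (𝐞 (inner ℝ z.1 x) : ℂ) := by fun_prop
    refine h.aestronglyMeasurable.smul ?_
    refine AEStronglyMeasurable.mul (Measurable.aestronglyMeasurable ?_) hv.comp_fst
    exact Complex.measurable_ofReal.comp (hw.comp measurable_swap)
  have hΦn (ξ : V) : ∫⁻ t in Set.Ioi 0, ‖Φ ξ t‖ₑ =
      (∫⁻ t in Set.Ioi 0, ENNReal.ofReal (w t ξ)) * ‖v ξ‖ₑ := by
    rw [← lintegral_mul_const _ (hw' ξ).ennreal_ofReal]
    refine setLIntegral_congr_fun measurableSet_Ioi fun t ht ↦ ?_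
    simp only [hΦ, Circle.smul_def, smul_eq_mul, enorm_mul]
    rw [← ofReal_norm (𝐞 (inner ℝ ξ x) : ℂ), Circle.norm_coe, ENNReal.ofReal_one, one_mul,
      ← ofReal_norm (w t ξ : ℂ), Complex.norm_real, norm_of_nonneg (hw0 t ht ξ)]
  have hΦi : Integrable (Function.uncurry Φ)
      ((volume : Measure V).prod (volume.restrict (Set.Ioi (0 : ℝ)))) := by
    refine ⟨hΦm, ?_⟩
    rw [hasFiniteIntegral_iff_enorm, lintegral_prod _ hΦm.enorm]
    simp only [Function.uncurry_apply_pair, hΦn]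
    calc _ = ∫⁻ ξ, ‖(M ξ : ℂ) * v ξ‖ₑ := by
          refine lintegral_congr_ae (hM.mono fun ξ hξ ↦ ?_)
          simp only [hξ, enorm_mul]
          rw [← ofReal_norm (M ξ : ℂ), Complex.norm_real, norm_of_nonneg (hM0 ξ)]
      _ < ∞ := hMv.2
  calc ‖𝓕⁻ (fun ξ ↦ (M ξ : ℂ) * v ξ) x‖ₑ = ‖∫ ξ, ∫ t in Set.Ioi 0, Φ ξ t‖ₑ := by
        rw [fourierInv_eq]
        congr 1
        refine integral_congr_ae (hM.mono fun ξ hξ ↦ ?_)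
        simp only [hΦ, Circle.smul_def, smul_eq_mul]
        rw [integral_const_mul, integral_mul_const, integral_complex_ofReal]
        congr 3
        rw [integral_eq_lintegral_of_nonneg_ae _ (hw' ξ).aestronglyMeasurable, hξ,
          ENNReal.toReal_ofReal (hM0 ξ)]
        filter_upwards [ae_restrict_mem measurableSet_Ioi] with t ht using hw0 t ht ξ
    _ = ‖∫ t in Set.Ioi 0, ∫ ξ, Φ ξ t‖ₑ := by rw [integral_integral_swap hΦi]
    _ ≤ ∫⁻ t in Set.Ioi 0, ‖∫ ξ, Φ ξ t‖ₑ := enorm_integral_le_lintegral_enorm _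
    _ = _ := by simp only [fourierInv_eq, hΦ]

lemma lintegral_rpow_mul_exp_neg_mul {a r : ℝ} (ha : 0 < a) (hr : 0 < r) :
    ∫⁻ t in Set.Ioi 0, ENNReal.ofReal (t ^ (a - 1) * exp (-t * r)) =
      ENNReal.ofReal (Gamma a * r ^ (-a)) := by
  have h := integral_rpow_mul_exp_neg_mul_Ioi ha hr
  have hG := Gamma_pos_of_pos ha
  have e : (1 / r) ^ a * Gamma a = Gamma a * r ^ (-a) := by
    rw [one_div, inv_rpow hr.le, rpow_neg hr.le, mul_comm]
  rw [e] at h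
  have h' : ∫ t in Set.Ioi 0, t ^ (a - 1) * exp (-t * r) = Gamma a * r ^ (-a) := by
    rw [← h]; congr 1; ext t; ring_nf
  rw [← ofReal_integral_eq_lintegral_ofReal, h']
  · exact .of_integral_ne_zero (by rw [h']; positivity)
  · filter_upwards [ae_restrict_mem measurableSet_Ioi] with t ht
    have := rpow_nonneg (le_of_lt (Set.mem_Ioi.1 ht)) (a - 1)
    positivity

lemma integrableOn_rpow_mul_one_sub_exp {a : ℝ} (ha : 0 < a) (ha1 : a < 1) :
    IntegrableOn (fun t ↦ t ^ (-a - 1) * (1 - exp (-t))) (Set.Ioi 0) := by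
  have hm : Measurable fun t : ℝ ↦ t ^ (-a - 1) * (1 - exp (-t)) := by fun_prop
  rw [← Set.Ioc_union_Ioi_eq_Ioi zero_le_one]
  refine IntegrableOn.union ?_ ?_
  · have h1 : IntegrableOn (fun t : ℝ ↦ t ^ (-a)) (Set.Ioc 0 1) :=
      (intervalIntegrable_iff_integrableOn_Ioc_of_le zero_le_one).1
        (intervalIntegral.intervalIntegrable_rpow' (by linarith))
    refine h1.mono' hm.aestronglyMeasurable ?_
    filter_upwards [ae_restrict_mem measurableSet_Ioc] with t ht
    have h2 := add_one_le_exp (-t)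
    have h3 : exp (-t) ≤ 1 := exp_le_one_iff.2 (by linarith [ht.1])
    have h4 := rpow_nonneg ht.1.le (-a - 1)
    rw [norm_of_nonneg (mul_nonneg h4 (by linarith))]
    calc _ ≤ t ^ (-a - 1) * t := by gcongr; linarith
      _ = _ := by rw [← rpow_add_one ht.1.ne']; ring_nf
  · have h1 : IntegrableOn (fun t : ℝ ↦ t ^ (-a - 1)) (Set.Ioi 1) :=
      integrableOn_Ioi_rpow_of_lt (by linarith) one_pos
    refine h1.mono' hm.aestronglyMeasurable ?_
    filter_upwards [ae_restrict_mem measurableSet_Ioi] with t ht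
    have ht0 : 0 < t := one_pos.trans ht
    have h3 : exp (-t) ≤ 1 := exp_le_one_iff.2 (by linarith)
    have h4 := rpow_nonneg ht0.le (-a - 1)
    rw [norm_of_nonneg (mul_nonneg h4 (by linarith))]
    exact mul_le_of_le_one_right h4 (by linarith [exp_pos (-t)])

lemma integral_rpow_mul_one_sub_exp_pos {a : ℝ} (ha : 0 < a) (ha1 : a < 1) :
    0 < ∫ t in Set.Ioi 0, t ^ (-a - 1) * (1 - exp (-t)) := by
  have hpos : ∀ t ∈ Set.Ioi (0 : ℝ), 0 < t ^ (-a - 1) * (1 - exp (-t)) := fun t ht ↦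
    mul_pos (rpow_pos_of_pos ht _) (sub_pos.2 (exp_lt_one_iff.2 (neg_lt_zero.2 ht)))
  rw [setIntegral_pos_iff_support_of_nonneg_ae _ (integrableOn_rpow_mul_one_sub_exp ha ha1)]
  · rw [Set.inter_eq_right.2 (fun t ht ↦ Function.mem_support.2 (hpos t ht).ne')]
    simp
  · filter_upwards [ae_restrict_mem measurableSet_Ioi] with t ht using (hpos t ht).le

lemma lintegral_rpow_mul_one_sub_exp {a r : ℝ} (ha : 0 < a) (ha1 : a < 1) (hr : 0 < r) :
    ∫⁻ t in Set.Ioi 0, ENNReal.ofReal (t ^ (-a - 1) * (1 - exp (-t * r))) =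
      ENNReal.ofReal ((∫ t in Set.Ioi 0, t ^ (-a - 1) * (1 - exp (-t))) * r ^ a) := by
  set φ : ℝ → ℝ := fun t ↦ t ^ (-a - 1) * (1 - exp (-t)) with hφ
  have hφr : ∀ t ∈ Set.Ioi (0 : ℝ),
      t ^ (-a - 1) * (1 - exp (-t * r)) = r ^ (a + 1) * φ (t * r) := fun t ht ↦ by
    rw [hφ]
    simp only
    rw [mul_rpow (le_of_lt ht) hr.le, show -a - 1 = -(a + 1) by ring, rpow_neg hr.le,
      neg_mul]
    have := rpow_pos_of_pos hr (a + 1)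
    field_simp
  have hi : IntegrableOn (fun t ↦ φ (t * r)) (Set.Ioi 0) := by
    rw [integrableOn_Ioi_comp_mul_right_iff _ _ hr, zero_mul]
    exact integrableOn_rpow_mul_one_sub_exp ha ha1
  rw [← ofReal_integral_eq_lintegral_ofReal]
  · rw [setIntegral_congr_fun measurableSet_Ioi hφr, integral_const_mul,
      integral_comp_mul_right_Ioi _ _ hr, zero_mul, rpow_add_one hr.ne', smul_eq_mul]
    congr 1
    field_simp
  · exact ((integrableOn_congr_fun hφr measurableSet_Ioi).2 (hi.const_mul _))
  · filter_upwards [ae_restrict_mem measurableSet_Ioi] with t ht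
    have ht0 : 0 < t := ht
    refine mul_nonneg (by positivity) (sub_nonneg.2 (exp_le_one_iff.2 ?_))
    nlinarith

variable [Nontrivial V]

lemma ae_norm_pos : ∀ᵐ ξ : V, 0 < ‖ξ‖ := by
  filter_upwards [compl_mem_ae_iff.2 (measure_singleton (μ := volume) (0 : V))] with ξ hξ
  exact norm_pos_iff.2 hξ

/-- A function is controlled by the heat potential of its fractional Laplacian. -/
lemma enorm_fourierInv_le_heatPotential {s : ℝ} (hs : 0 < s) {u : V → ℂ} (hu : Integrable u)
    (hsu : Integrable fun ξ ↦ (((2 * π * ‖ξ‖) ^ s : ℝ) : ℂ) * u ξ) (x : V) :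
    ENNReal.ofReal (Gamma (s / 2) * ‖𝓕⁻ u x‖) ≤ heatPotential (s / 2)
      (fun y ↦ ‖𝓕⁻ (fun ξ ↦ (((2 * π * ‖ξ‖) ^ s : ℝ) : ℂ) * u ξ) y‖ₑ) x := by
  set v : V → ℂ := fun ξ ↦ (((2 * π * ‖ξ‖) ^ s : ℝ) : ℂ) * u ξ with hv
  set M : V → ℝ := fun ξ ↦ Gamma (s / 2) * ((2 * π * ‖ξ‖) ^ 2) ^ (-(s / 2)) with hM
  have hG := Gamma_pos_of_pos (half_pos hs)
  have hMv : (fun ξ ↦ (M ξ : ℂ) * v ξ) =ᵐ[volume] fun ξ ↦ (Gamma (s / 2) : ℂ) * u ξ := by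
    filter_upwards [ae_norm_pos] with ξ hξ
    have : ((2 * π * ‖ξ‖) ^ 2) ^ (-(s / 2)) * (2 * π * ‖ξ‖) ^ s = 1 := by
      rw [← rpow_natCast, ← rpow_mul (by positivity), ← rpow_add (by positivity)]
      norm_num
      ring_nf
      simp
    simp only [hv, hM]
    rw [← mul_assoc, ← Complex.ofReal_mul, mul_assoc, this, mul_one]
  have h := enorm_fourierInv_le_lintegral
    (w := fun t ξ ↦ t ^ (s / 2 - 1) * exp (-t * (2 * π * ‖ξ‖) ^ 2)) (M := M) (v := v)
    (by unfold Function.uncurry; fun_prop) (fun t ht ξ ↦ by positivity) (fun ξ ↦ by positivity)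
    (by filter_upwards [ae_norm_pos] with ξ hξ using
      lintegral_rpow_mul_exp_neg_mul (half_pos hs) (by positivity))
    hsu.1 ((hu.const_mul _).congr hMv.symm) x
  rw [fourierInv_congr_ae hMv, fourierInv_const_mul, ← ofReal_norm, norm_mul, Complex.norm_real,
    norm_of_nonneg hG.le] at h
  refine h.trans (setLIntegral_mono' measurableSet_Ioi fun t ht ↦ ?_)
  have ht0 : 0 < t := ht
  simp only [Complex.ofReal_mul, mul_assoc (((t ^ (s / 2 - 1) : ℝ) : ℂ))]
  rw [fourierInv_const_mul, ← integral_heatKernel_mul_fourierInv ht0 hsu, enorm_mul,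
    ← ofReal_norm (((t ^ (s / 2 - 1) : ℝ) : ℂ)), Complex.norm_real, norm_of_nonneg (by positivity)]
  gcongr
  refine (enorm_integral_le_lintegral_enorm _).trans_eq (lintegral_congr fun y ↦ ?_)
  rw [enorm_mul, ← ofReal_norm ((heatKernel t (x - y) : ℝ) : ℂ), Complex.norm_real,
    norm_of_nonneg (heatKernel_nonneg ht0.le _)]

end Subordination

section FractionalLaplacianIntegrable

open scoped ENNReal

variable {V : Type*} [NormedAddCommGroup V] [InnerProductSpace ℝ V] [MeasurableSpace V]
  [BorelSpace V] [FiniteDimensional ℝ V]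

/-- The modulus of continuity in `L¹` is controlled by the `L¹` norm of the derivative. -/
lemma lintegral_enorm_sub_translate_le {f : V → ℂ} (hf : ContDiff ℝ 1 f) (z : V) :
    ∫⁻ x, ‖f x - f (x - z)‖ₑ ≤ ‖z‖ₑ * ∫⁻ x, ‖fderiv ℝ f x‖ₑ := by
  have hc : Continuous (fderiv ℝ f) := hf.continuous_fderiv one_ne_zero
  have hpt (x : V) : ‖f x - f (x - z)‖ₑ ≤
      ∫⁻ r in Set.Icc (0 : ℝ) 1, ‖fderiv ℝ f (x - r • z)‖ₑ * ‖z‖ₑ := by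
    have h := enorm_sub_le_lintegral_deriv_of_contDiffOn_Icc (f := fun r : ℝ ↦ f (x - r • z))
      (a := 0) (b := 1) (ContDiff.contDiffOn (by fun_prop)) zero_le_one
    simp only [one_smul, zero_smul, sub_zero] at h
    rw [← enorm_neg, neg_sub]
    refine h.trans (lintegral_mono fun r ↦ ?_)
    have h1 : HasDerivAt (fun r : ℝ ↦ x - r • z) (-z) r := by
      simpa using ((hasDerivAt_id r).smul_const z).const_sub x
    have h2 := ((hf.differentiable one_ne_zero) (x - r • z)).hasFDerivAt.comp_hasDerivAt r h1
    have h3 : deriv (fun r : ℝ ↦ f (x - r • z)) r = fderiv ℝ f (x - r • z) (-z) := h2.deriv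
    rw [h3, ← enorm_neg z]
    exact ContinuousLinearMap.le_opENorm _ _
  calc _ ≤ ∫⁻ x, ∫⁻ r in Set.Icc (0 : ℝ) 1, ‖fderiv ℝ f (x - r • z)‖ₑ * ‖z‖ₑ :=
        lintegral_mono hpt
    _ = ∫⁻ r in Set.Icc (0 : ℝ) 1, ∫⁻ x, ‖fderiv ℝ f (x - r • z)‖ₑ * ‖z‖ₑ := by
        refine lintegral_lintegral_swap (Continuous.aemeasurable ?_)
        unfold Function.uncurry
        refine ENNReal.continuous_mul_const enorm_ne_top |>.comp ?_
        fun_prop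
    _ = ∫⁻ r in Set.Icc (0 : ℝ) 1, ‖z‖ₑ * ∫⁻ x, ‖fderiv ℝ f x‖ₑ := by
        refine lintegral_congr fun r ↦ ?_
        rw [lintegral_mul_const _ (Continuous.measurable (by fun_prop)), mul_comm,
          lintegral_sub_right_eq_self (fun x ↦ ‖fderiv ℝ f x‖ₑ)]
    _ = _ := by simp

/-- The mean oscillation of `f` around `x` at scale `√t`, weighted by the heat kernel. -/
noncomputable def heatOsc (t : ℝ) (f : V → ℂ) (x : V) : ℝ≥0∞ :=
  ∫⁻ y, ENNReal.ofReal (heatKernel t (x - y)) * ‖f x - f y‖ₑ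

lemma measurable_heatOsc_uncurry {f : V → ℂ} (hf : Measurable f) :
    Measurable (fun z : V × ℝ ↦ heatOsc z.2 f z.1) := by
  unfold heatOsc
  refine Measurable.lintegral_prod_right' (f := fun w : (V × ℝ) × V ↦
    ENNReal.ofReal (heatKernel w.1.2 (w.1.1 - w.2)) * ‖f w.1.1 - f w.2‖ₑ) ?_
  have h : Measurable fun w : (V × ℝ) × V ↦ ENNReal.ofReal (heatKernel w.1.2 (w.1.1 - w.2)) :=
    ENNReal.measurable_ofReal.comp (measurable_heatKernel_uncurry.comp
      (f := fun w : (V × ℝ) × V ↦ (w.1.2, w.1.1 - w.2)) (by fun_prop))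
  fun_prop

lemma lintegral_heatOsc (t : ℝ) {f : V → ℂ} (hf : Measurable f) :
    ∫⁻ x, heatOsc t f x =
      ∫⁻ z, ENNReal.ofReal (heatKernel t z) * ∫⁻ x, ‖f x - f (x - z)‖ₑ := by
  have hk := measurable_heatKernel (V := V) t
  calc ∫⁻ x, heatOsc t f x
      = ∫⁻ x, ∫⁻ z, ENNReal.ofReal (heatKernel t z) * ‖f x - f (x - z)‖ₑ := by
        refine lintegral_congr fun x ↦ ?_
        rw [← lintegral_sub_left_eq_self _ x, heatOsc]
        simp only [sub_sub_cancel]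
    _ = _ := by
        rw [lintegral_lintegral_swap (by unfold Function.uncurry; fun_prop)]
        exact lintegral_congr fun z ↦ lintegral_const_mul _ (by fun_prop)

lemma lintegral_heatOsc_le {t : ℝ} (ht : 0 < t) {f : V → ℂ} (hf : Measurable f) :
    ∫⁻ x, heatOsc t f x ≤ 2 * ∫⁻ x, ‖f x‖ₑ := by
  rw [lintegral_heatOsc t hf]
  calc _ ≤ ∫⁻ z : V, ENNReal.ofReal (heatKernel t z) * (2 * ∫⁻ x, ‖f x‖ₑ) := by
        gcongr with z
        calc _ ≤ ∫⁻ x, (‖f x‖ₑ + ‖f (x - z)‖ₑ) := lintegral_mono fun x ↦ enorm_sub_le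
          _ = _ := by
            rw [lintegral_add_left (by fun_prop), lintegral_sub_right_eq_self (fun x ↦ ‖f x‖ₑ),
              two_mul]
    _ = _ := by
        rw [lintegral_mul_const _ (measurable_heatKernel t).ennreal_ofReal,
          lintegral_heatKernel ht, one_mul]

lemma lintegral_heatOsc_le_sqrt {t : ℝ} (ht : 0 < t) {f : V → ℂ} (hf : ContDiff ℝ 1 f) :
    ∫⁻ x, heatOsc t f x ≤ ENNReal.ofReal (t ^ (1 / 2 : ℝ)) *
      (ENNReal.ofReal (2 * 2 ^ (Module.finrank ℝ V / 2 : ℝ)) * ∫⁻ x, ‖fderiv ℝ f x‖ₑ) := by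
  rw [lintegral_heatOsc t hf.continuous.measurable]
  have hk := measurable_heatKernel (V := V) (2 * t)
  calc _ ≤ ∫⁻ z : V, ENNReal.ofReal (heatKernel t z) * (‖z‖ₑ * ∫⁻ x, ‖fderiv ℝ f x‖ₑ) := by
        gcongr with z
        exact lintegral_enorm_sub_translate_le hf z
    _ ≤ ∫⁻ z : V, ENNReal.ofReal (2 * 2 ^ (Module.finrank ℝ V / 2 : ℝ) * t ^ (1 / 2 : ℝ)) *
          ENNReal.ofReal (heatKernel (2 * t) z) * ∫⁻ x, ‖fderiv ℝ f x‖ₑ := by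
        refine lintegral_mono fun z ↦ ?_
        rw [← mul_assoc, ← ofReal_norm z, ← ENNReal.ofReal_mul (heatKernel_nonneg ht.le z),
          ← ENNReal.ofReal_mul (by positivity)]
        gcongr ENNReal.ofReal ?_ * _
        exact heatKernel_mul_norm_le ht z
    _ = _ := by
        rw [lintegral_mul_const _ (by fun_prop), lintegral_const_mul _ (by fun_prop),
          lintegral_heatKernel (by positivity), mul_one, mul_comm (2 * _) (t ^ _),
          ENNReal.ofReal_mul (by positivity), mul_assoc]

lemma continuous_fourierInv {u : V → ℂ} (hu : Integrable u) : Continuous (𝓕⁻ u) := by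
  rw [fourierInv_eq_fourier_comp_neg]
  exact VectorFourier.fourierIntegral_continuous continuous_fourierChar
    (innerSL ℝ).continuous₂ hu.comp_neg

variable [Nontrivial V]

lemma enorm_fourierInv_le_lintegral_heatOsc {s : ℝ} (hs : 0 < s) (hs2 : s < 2) {u : V → ℂ}
    (hu : Integrable u) (hsu : Integrable fun ξ ↦ (((2 * π * ‖ξ‖) ^ s : ℝ) : ℂ) * u ξ)
    (hf : Integrable (𝓕⁻ u)) (x : V) :
    ENNReal.ofReal (∫ t in Set.Ioi 0, t ^ (-(s / 2) - 1) * (1 - exp (-t))) *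
        ‖𝓕⁻ (fun ξ ↦ (((2 * π * ‖ξ‖) ^ s : ℝ) : ℂ) * u ξ) x‖ₑ ≤
      ∫⁻ t in Set.Ioi 0, ENNReal.ofReal (t ^ (-(s / 2) - 1)) * heatOsc t (𝓕⁻ u) x := by
  set c := ∫ t in Set.Ioi 0, t ^ (-(s / 2) - 1) * (1 - exp (-t))
  have hc : 0 < c := integral_rpow_mul_one_sub_exp_pos (half_pos hs) (by linarith)
  have hpow (ξ : V) : ((2 * π * ‖ξ‖) ^ 2) ^ (s / 2) = (2 * π * ‖ξ‖) ^ s := by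
    rw [← rpow_natCast, ← rpow_mul (by positivity)]
    congr 1; push_cast; ring
  set v : V → ℂ := fun ξ ↦ (((2 * π * ‖ξ‖) ^ s : ℝ) : ℂ) * u ξ with hv
  have hMv : (fun ξ ↦ ((c * (2 * π * ‖ξ‖) ^ s : ℝ) : ℂ) * u ξ) = fun ξ ↦ (c : ℂ) * v ξ := by
    ext ξ; rw [hv]; push_cast; ring
  have h := enorm_fourierInv_le_lintegral
    (w := fun t ξ ↦ t ^ (-(s / 2) - 1) * (1 - exp (-t * (2 * π * ‖ξ‖) ^ 2)))
    (M := fun ξ ↦ c * (2 * π * ‖ξ‖) ^ s) (v := u)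
    (by unfold Function.uncurry; fun_prop)
    (fun t ht ξ ↦ mul_nonneg (by positivity) (sub_nonneg.2 (exp_le_one_iff.2 (by
      rw [neg_mul, neg_nonpos]; positivity))))
    (fun ξ ↦ by positivity)
    (by filter_upwards [ae_norm_pos] with ξ hξ using (lintegral_rpow_mul_one_sub_exp
      (half_pos hs) (by linarith) (by positivity)).trans (by rw [hpow]))
    hu.1 (by rw [hMv]; exact hsu.const_mul _) x
  rw [hMv, fourierInv_const_mul, enorm_mul, ← ofReal_norm (c : ℂ), Complex.norm_real,
    norm_of_nonneg hc.le] at h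
  refine h.trans (setLIntegral_mono' measurableSet_Ioi fun t ht ↦ ?_)
  have ht0 : 0 < t := ht
  have hsplit : (fun ξ ↦
      ((t ^ (-(s / 2) - 1) * (1 - exp (-t * (2 * π * ‖ξ‖) ^ 2)) : ℝ) : ℂ) * u ξ) =
      fun ξ ↦ ((t ^ (-(s / 2) - 1) : ℝ) : ℂ) *
        (u ξ - ((exp (-t * (2 * π * ‖ξ‖) ^ 2) : ℝ) : ℂ) * u ξ) := by
    ext ξ; push_cast; ring
  have hgi : Integrable fun ξ ↦ ((exp (-t * (2 * π * ‖ξ‖) ^ 2) : ℝ) : ℂ) * u ξ := by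
    refine hu.mono ((Continuous.aestronglyMeasurable (by fun_prop)).mul hu.1)
      (.of_forall fun ξ ↦ ?_)
    rw [norm_mul, Complex.norm_real, norm_of_nonneg (exp_pos _).le]
    refine mul_le_of_le_one_left (norm_nonneg _) (exp_le_one_iff.2 ?_)
    rw [neg_mul, neg_nonpos]
    positivity
  have hk : Integrable fun y ↦ (heatKernel t (x - y) : ℂ) :=
    ((integrable_heatKernel ht0).comp_sub_left x).ofReal
  have hkb : Integrable fun y ↦ (heatKernel t (x - y) : ℂ) * 𝓕⁻ u y := by
    refine hf.bdd_mul hk.1 (c := (4 * π * t) ^ (-(Module.finrank ℝ V / 2 : ℝ)))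
      (.of_forall fun y ↦ ?_)
    rw [Complex.norm_real, norm_of_nonneg (heatKernel_nonneg ht0.le _)]
    exact heatKernel_le ht0 _
  have hone : ∫ y, (heatKernel t (x - y) : ℂ) = 1 := by
    rw [integral_complex_ofReal, integral_sub_left_eq_self (heatKernel t) volume x,
      integral_heatKernel ht0, Complex.ofReal_one]
  have hosc : 𝓕⁻ u x - 𝓕⁻ (fun ξ ↦ ((exp (-t * (2 * π * ‖ξ‖) ^ 2) : ℝ) : ℂ) * u ξ) x =
      ∫ y, (heatKernel t (x - y) : ℂ) * (𝓕⁻ u x - 𝓕⁻ u y) := by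
    rw [← integral_heatKernel_mul_fourierInv ht0 hu]
    simp only [mul_sub]
    rw [integral_sub (hk.mul_const _) hkb, integral_mul_const, hone, one_mul]
  rw [hsplit, fourierInv_const_mul, fourierInv_sub hu hgi, hosc, enorm_mul,
    ← ofReal_norm (((t ^ (-(s / 2) - 1) : ℝ) : ℂ)), Complex.norm_real,
    norm_of_nonneg (by positivity)]
  gcongr
  refine (enorm_integral_le_lintegral_enorm _).trans_eq (lintegral_congr fun y ↦ ?_)
  rw [enorm_mul, ← ofReal_norm ((heatKernel t (x - y) : ℝ) : ℂ), Complex.norm_real,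
    norm_of_nonneg (heatKernel_nonneg ht0.le _)]

/-- For `0 < s < 1`, the fractional Laplacian of order `s` of an integrable `C¹` function with
integrable derivative is integrable. -/
lemma lintegral_enorm_fourierInv_rpow_mul_lt_top {s : ℝ} (hs : 0 < s) (hs1 : s < 1) {u : V → ℂ}
    (hu : Integrable u) (hsu : Integrable fun ξ ↦ (((2 * π * ‖ξ‖) ^ s : ℝ) : ℂ) * u ξ)
    (hf : Integrable (𝓕⁻ u)) (hfd : ContDiff ℝ 1 (𝓕⁻ u)) (hfi : Integrable (fderiv ℝ (𝓕⁻ u))) :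
    ∫⁻ x, ‖𝓕⁻ (fun ξ ↦ (((2 * π * ‖ξ‖) ^ s : ℝ) : ℂ) * u ξ) x‖ₑ < ∞ := by
  set c := ∫ t in Set.Ioi 0, t ^ (-(s / 2) - 1) * (1 - exp (-t))
  have hc : 0 < c := integral_rpow_mul_one_sub_exp_pos (half_pos hs) (by linarith)
  have hm := measurable_heatOsc_uncurry hfd.continuous.measurable
  set A : ℝ≥0∞ := ENNReal.ofReal (2 * 2 ^ (Module.finrank ℝ V / 2 : ℝ)) *
    ∫⁻ x, ‖fderiv ℝ (𝓕⁻ u) x‖ₑ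
  set B : ℝ≥0∞ := 2 * ∫⁻ x, ‖𝓕⁻ u x‖ₑ
  have hA : A < ∞ := ENNReal.mul_lt_top ENNReal.ofReal_lt_top hfi.2
  have hB : B < ∞ := ENNReal.mul_lt_top ENNReal.ofNat_lt_top hf.2
  have hsmall : ∫⁻ t in Set.Ioc 0 1, ENNReal.ofReal (t ^ (-(s / 2) - 1)) *
      ∫⁻ x, heatOsc t (𝓕⁻ u) x ≤ ENNReal.ofReal (1 ^ ((1 - s) / 2) / ((1 - s) / 2)) * A := by
    rw [← lintegral_Ioc_rpow (by linarith) zero_le_one, ← lintegral_mul_const _ (by fun_prop)]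
    refine setLIntegral_mono' measurableSet_Ioc fun t ht ↦ ?_
    have ht0 : 0 < t := ht.1
    calc _ ≤ ENNReal.ofReal (t ^ (-(s / 2) - 1)) * (ENNReal.ofReal (t ^ (1 / 2 : ℝ)) * A) := by
          gcongr
          exact lintegral_heatOsc_le_sqrt ht0 hfd
      _ = _ := by
          rw [← mul_assoc, ← ENNReal.ofReal_mul (by positivity), ← rpow_add ht0]
          ring_nf
  have hlarge : ∫⁻ t in Set.Ioi 1, ENNReal.ofReal (t ^ (-(s / 2) - 1)) *
      ∫⁻ x, heatOsc t (𝓕⁻ u) x ≤ ENNReal.ofReal (1 ^ (-(s / 2)) / (s / 2)) * B := by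
    rw [← lintegral_Ioi_rpow (by linarith) one_pos, ← lintegral_mul_const _ (by fun_prop)]
    refine setLIntegral_mono' measurableSet_Ioi fun t ht ↦ ?_
    gcongr
    exact lintegral_heatOsc_le (one_pos.trans ht) hfd.continuous.measurable
  have hgm : Measurable fun x ↦ ‖𝓕⁻ (fun ξ ↦ (((2 * π * ‖ξ‖) ^ s : ℝ) : ℂ) * u ξ) x‖ₑ :=
    (continuous_fourierInv hsu).enorm.measurable
  refine ENNReal.lt_top_of_mul_ne_top_right (a := ENNReal.ofReal c) (ne_of_lt ?_)
    (by simpa using hc)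
  rw [← lintegral_const_mul _ hgm]
  calc _ ≤ ∫⁻ x, ∫⁻ t in Set.Ioi 0, ENNReal.ofReal (t ^ (-(s / 2) - 1)) * heatOsc t (𝓕⁻ u) x :=
        lintegral_mono fun x ↦
          enorm_fourierInv_le_lintegral_heatOsc hs (by linarith) hu hsu hf x
    _ = ∫⁻ t in Set.Ioi 0, ENNReal.ofReal (t ^ (-(s / 2) - 1)) * ∫⁻ x, heatOsc t (𝓕⁻ u) x := by
        have hm' : Measurable fun z : V × ℝ ↦
            ENNReal.ofReal (z.2 ^ (-(s / 2) - 1)) * heatOsc z.2 (𝓕⁻ u) z.1 := by fun_prop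
        rw [lintegral_lintegral_swap hm'.aemeasurable]
        exact lintegral_congr fun t ↦ lintegral_const_mul _
          (hm.comp (f := fun x : V ↦ (x, t)) (by fun_prop))
    _ ≤ ENNReal.ofReal (1 ^ ((1 - s) / 2) / ((1 - s) / 2)) * A +
          ENNReal.ofReal (1 ^ (-(s / 2)) / (s / 2)) * B := by
        rw [← Set.Ioc_union_Ioi_eq_Ioi zero_le_one,
          lintegral_union measurableSet_Ioi (Set.Ioc_disjoint_Ioi le_rfl)]
        exact add_le_add hsmall hlarge
    _ < ∞ := ENNReal.add_lt_top.2 ⟨ENNReal.mul_lt_top ENNReal.ofReal_lt_top hA,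
        ENNReal.mul_lt_top ENNReal.ofReal_lt_top hB⟩

end FractionalLaplacianIntegrable

section FractionalSobolev

open scoped ENNReal

variable {V : Type*} [NormedAddCommGroup V] [InnerProductSpace ℝ V] [MeasurableSpace V]
  [BorelSpace V] [FiniteDimensional ℝ V]

lemma heatPotential_const_mul (a : ℝ) {c : ℝ≥0∞} (hc : c ≠ ∞) (G : V → ℝ≥0∞) (x : V) :
    heatPotential a (fun y ↦ c * G y) x = c * heatPotential a G x := by
  unfold heatPotential heatAvg
  rw [← lintegral_const_mul' _ _ hc]
  refine lintegral_congr fun t ↦ ?_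
  rw [mul_left_comm, ← lintegral_const_mul' _ _ hc]
  simp only [mul_left_comm]

lemma lintegral_rpow_norm_lt_top {g : V → ℂ} {p M : ℝ} (hp : 1 ≤ p) (hM : ∀ x, ‖g x‖ ≤ M)
    (hg : ∫⁻ x, ‖g x‖ₑ < ∞) : ∫⁻ x, ENNReal.ofReal (‖g x‖ ^ p) < ∞ := by
  have hM0 : 0 ≤ M := (norm_nonneg _).trans (hM 0)
  calc _ ≤ ∫⁻ x, ENNReal.ofReal (M ^ (p - 1)) * ‖g x‖ₑ := by
        refine lintegral_mono fun x ↦ ?_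
        rw [← ofReal_norm, ← ENNReal.ofReal_mul (by positivity)]
        refine ENNReal.ofReal_le_ofReal ?_
        calc ‖g x‖ ^ p = ‖g x‖ ^ ((p - 1) + 1) := by ring_nf
          _ = ‖g x‖ ^ (p - 1) * ‖g x‖ := by
              rw [rpow_add_of_nonneg (norm_nonneg _) (by linarith) zero_le_one, rpow_one]
          _ ≤ _ := by
              gcongr
              exact hM x
    _ < ∞ := by
        rw [lintegral_const_mul' _ _ ENNReal.ofReal_ne_top]
        exact ENNReal.mul_lt_top ENNReal.ofReal_lt_top hg

lemma integrable_rpow_mul_schwartz {s : ℝ} (hs : 0 < s) (hs1 : s < 1) (u : SchwartzMap V ℂ) :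
    Integrable fun ξ ↦ (((2 * π * ‖ξ‖) ^ s : ℝ) : ℂ) * u ξ := by
  have h0 : Integrable fun ξ ↦ ‖u ξ‖ := u.integrable.norm
  have h1 := (u.integrable_pow_mul volume 1).const_mul (2 * π)
  refine (h0.add h1).mono' (AEStronglyMeasurable.mul ?_ u.continuous.aestronglyMeasurable)
    (.of_forall fun ξ ↦ ?_)
  · refine Continuous.aestronglyMeasurable (Complex.continuous_ofReal.comp ?_)
    exact (by fun_prop : Continuous fun ξ : V ↦ 2 * π * ‖ξ‖).rpow_const fun _ ↦ .inr hs.le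
  · have hr : (0 : ℝ) ≤ 2 * π * ‖ξ‖ := by positivity
    have hle : (2 * π * ‖ξ‖) ^ s ≤ 1 + 2 * π * ‖ξ‖ := by
      have := rpow_one_add_le_one_add_mul_self (s := 2 * π * ‖ξ‖ - 1) (by linarith) hs.le hs1.le
      rw [add_sub_cancel] at this
      nlinarith
    rw [norm_mul, Complex.norm_real, norm_of_nonneg (by positivity), Pi.add_apply, pow_one]
    calc _ ≤ (1 + 2 * π * ‖ξ‖) * ‖u ξ‖ := by gcongr
      _ = _ := by ring

lemma norm_fourierInv_le (v : V → ℂ) (x : V) : ‖𝓕⁻ v x‖ ≤ ∫ ξ, ‖v ξ‖ := by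
  rw [fourierInv_eq]
  refine (norm_integral_le_integral_norm _).trans_eq (integral_congr_ae (.of_forall fun ξ ↦ ?_))
  simp

end FractionalSobolev

lemma lpNorm_le_of_lintegral_le {n : ℕ} {p K : ℝ} (hp : 0 < p) (hK : 0 ≤ K)
    {f : EuclideanSpace ℝ (Fin n) → ℂ} (hf : Continuous f)
    (h : ∫⁻ x, ENNReal.ofReal (‖f x‖ ^ p) ≤ ENNReal.ofReal (K ^ p)) : _root_.lpNorm n p f ≤ K := by
  unfold _root_.lpNorm
  rw [integral_eq_lintegral_of_nonneg_ae (.of_forall fun x ↦ by positivity)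
    (hf.norm.rpow_const fun _ ↦ .inr hp.le).aestronglyMeasurable, one_div,
    rpow_inv_le_iff_of_pos ENNReal.toReal_nonneg hK hp]
  exact ENNReal.toReal_le_of_le_ofReal (by positivity) h

lemma lintegral_le_of_lpNorm_le {n : ℕ} {p K : ℝ} (hp : 0 < p) (hK : 0 ≤ K)
    {f : EuclideanSpace ℝ (Fin n) → ℂ} (hf : Continuous f)
    (hfin : ∫⁻ x, ENNReal.ofReal (‖f x‖ ^ p) < ⊤) (h : _root_.lpNorm n p f ≤ K) :
    ∫⁻ x, ENNReal.ofReal (‖f x‖ ^ p) ≤ ENNReal.ofReal (K ^ p) := by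
  unfold _root_.lpNorm at h
  rw [integral_eq_lintegral_of_nonneg_ae (.of_forall fun x ↦ by positivity)
    (hf.norm.rpow_const fun _ ↦ .inr hp.le).aestronglyMeasurable, one_div,
    rpow_inv_le_iff_of_pos ENNReal.toReal_nonneg hK hp] at h
  rw [← ENNReal.ofReal_toReal hfin.ne]
  exact ENNReal.ofReal_le_ofReal h

theorem statement15 (n : ℕ) (hn : 1 ≤ n) (s : ℝ) (hs0 : 0 < s) (hs1 : s < 1)
    (p q : ℝ) (hp1 : 1 < p) (hpn : p < n / s) (hq : q = n * p / (n - s * p)) :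
    ∃ C : ℝ, 0 < C ∧
      ∀ f : SchwartzMap (EuclideanSpace ℝ (Fin n)) ℂ,
        lpNorm n q ⇑f ≤ C * lpNorm n p (fracLap n s ⇑f) := by
  have : Nonempty (Fin n) := ⟨⟨0, hn⟩⟩
  have hp0 : 0 < p := by linarith
  have hn0 : (0 : ℝ) < n := by exact_mod_cast hn
  have hnsp : 0 < n - s * p := by
    rw [lt_div_iff₀ hs0] at hpn
    linarith
  have hq0 : 0 < q := by rw [hq]; positivity
  have hb : (0 : ℝ) < n / (2 * q) := by positivity
  obtain ⟨C₀, hC₀, hHLS⟩ := exists_lintegral_rpow_le_of_le_heatPotential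
    (V := EuclideanSpace ℝ (Fin n)) (half_pos hs0) hb hp1
    (by rw [finrank_euclideanSpace_fin, hq]; field_simp; ring)
    (by rw [finrank_euclideanSpace_fin])
  have hΓ : 0 < Gamma (s / 2) := Gamma_pos_of_pos (half_pos hs0)
  refine ⟨C₀ ^ (1 / q) / Gamma (s / 2), by positivity, fun f ↦ ?_⟩
  set g := fracLap n s ⇑f with hg
  have hu : Integrable (𝓕 ⇑f) := (𝓕 f).integrable
  have hsu : Integrable fun ξ ↦ (((2 * π * ‖ξ‖) ^ s : ℝ) : ℂ) * 𝓕 (⇑f) ξ :=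
    integrable_rpow_mul_schwartz hs0 hs1 (𝓕 f)
  have hinv : 𝓕⁻ (𝓕 ⇑f) = ⇑f := f.continuous.fourierInv_fourier_eq f.integrable hu
  have hgc : Continuous g := continuous_fourierInv hsu
  have hg1 : ∫⁻ x, ‖g x‖ₑ < ⊤ := by
    refine lintegral_enorm_fourierInv_rpow_mul_lt_top hs0 hs1 hu hsu ?_ ?_ ?_ <;> rw [hinv]
    · exact f.integrable
    · exact f.smooth 1
    · exact (SchwartzMap.fderivCLM ℝ _ ℂ f).integrable
  have hgp : ∫⁻ x, ENNReal.ofReal (‖g x‖ ^ p) < ⊤ :=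
    lintegral_rpow_norm_lt_top hp1.le (norm_fourierInv_le _) hg1
  have hpot (x) : ENNReal.ofReal (Gamma (s / 2) * ‖f x‖) ≤
      heatPotential (s / 2) (fun y ↦ ‖g y‖ₑ) x := by
    have := enorm_fourierInv_le_heatPotential hs0 hu hsu x
    rwa [hinv] at this
  rw [← div_le_iff₀' (by positivity)]
  refine le_of_forall_gt_imp_ge_of_dense fun A hA ↦ ?_
  have hA0 : 0 < A := (rpow_nonneg (integral_nonneg fun _ ↦ by positivity) _).trans_lt hA
  rw [div_le_iff₀' (by positivity)]
  refine lpNorm_le_of_lintegral_le hq0 (by positivity) f.continuous ?_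
  have hgA := lintegral_le_of_lpNorm_le hp0 hA0.le hgc hgp hA.le
  have key := hHLS (fun x ↦ A⁻¹ * (Gamma (s / 2) * ‖f x‖)) (fun x ↦ A⁻¹ * ‖g x‖)
    (by fun_prop) (by fun_prop) (fun x ↦ by positivity) (fun x ↦ by positivity)
    (fun x ↦ ?_) ?_
  · have hscale (x) : ‖f x‖ ^ q = (A / Gamma (s / 2)) ^ q *
        (A⁻¹ * (Gamma (s / 2) * ‖f x‖)) ^ q := by
      rw [← mul_rpow (by positivity) (by positivity)]
      congr 1
      field_simp
    have hC : (C₀ ^ (1 / q) / Gamma (s / 2) * A) ^ q = (A / Gamma (s / 2)) ^ q * C₀ := by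
      rw [div_mul_eq_mul_div, mul_div_assoc, mul_rpow (by positivity) (by positivity),
        ← rpow_mul hC₀.le, one_div_mul_cancel hq0.ne', rpow_one, mul_comm]
    simp_rw [hscale, hC]
    rw [ENNReal.ofReal_mul (by positivity)]
    simp_rw [ENNReal.ofReal_mul (rpow_nonneg (div_nonneg hA0.le hΓ.le) q)]
    rw [lintegral_const_mul' _ _ ENNReal.ofReal_ne_top]
    gcongr
  · have hcomp : ENNReal.ofReal ∘ (fun y ↦ A⁻¹ * ‖g y‖) =
        fun y ↦ ENNReal.ofReal A⁻¹ * ‖g y‖ₑ := by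
      ext y
      rw [Function.comp_apply, ENNReal.ofReal_mul (by positivity), ofReal_norm]
    rw [hcomp, heatPotential_const_mul _ ENNReal.ofReal_ne_top,
      ENNReal.ofReal_mul (by positivity)]
    gcongr
    exact hpot x
  · calc ∫⁻ y, ENNReal.ofReal ((A⁻¹ * ‖g y‖) ^ p)
        = ENNReal.ofReal (A⁻¹ ^ p) * ∫⁻ y, ENNReal.ofReal (‖g y‖ ^ p) := by
          rw [← lintegral_const_mul' _ _ ENNReal.ofReal_ne_top]
          refine lintegral_congr fun y ↦ ?_
          rw [mul_rpow (by positivity) (by positivity), ENNReal.ofReal_mul (by positivity)]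
      _ ≤ ENNReal.ofReal (A⁻¹ ^ p) * ENNReal.ofReal (A ^ p) := by gcongr
      _ = 1 := by
          rw [← ENNReal.ofReal_mul (by positivity), ← mul_rpow (by positivity) hA0.le,
            inv_mul_cancel₀ hA0.ne', one_rpow, ENNReal.ofReal_one]
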